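/- Assume the Riemann Hypothesis. Then no integer k with 10^11 < k < 3·10^13 is a P-integer. -/

import Mathlib

open scoped BigOperators

/-- Number of primes not exceeding the real number `x` (so `primePi x = 0` for `x ≤ 1`). -/
noncomputable def primePi (x : ℝ) : ℕ :=
  ((Finset.range (⌊x⌋₊ + 1)).filter Nat.Prime).card

/-- The `n`-th prime, with `nthPrime 1 = 2`, `nthPrime 2 = 3`, etc. -/
noncomputable def nthPrime (n : ℕ) : ℕ := Nat.nth Nat.Prime (n - 1)
/-- The `i`-th (0-indexed) prime not dividing `k`, in increasing order. -/
noncomputable def nthPrimeNotDvd (k i : ℕ) : ℕ := Nat.nth (fun p => p.Prime ∧ ¬ p ∣ k) i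

/-- `k` is a `P`-integer: `k > 1` and the first `φ(k)` primes not dividing `k` are pairwise
incongruent modulo `k` and their residues are exactly the residues coprime to `k`. -/
def IsPInteger (k : ℕ) : Prop :=
  1 < k ∧
  Set.InjOn (fun i => nthPrimeNotDvd k i % k) (Set.Iio k.totient) ∧
  (fun i => nthPrimeNotDvd k i % k) '' Set.Iio k.totient = {r | r < k ∧ Nat.Coprime r k}

section ChebyshevBound
open Real Chebyshev ArithmeticFunction
open scoped ArithmeticFunction.zeta

lemma log_factorial_eq_sum_vonMangoldt {N N' : ℕ} (h : N ≤ N') :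
    Real.log (N.factorial : ℝ) = ∑ d ∈ Finset.Ioc 0 N', Λ d * ((N / d : ℕ) : ℝ) := by
  have hlog : Real.log (N.factorial : ℝ) = ∑ n ∈ Finset.Ioc 0 N, (Λ * ζ) n := by
    rw [vonMangoldt_mul_zeta]
    clear h
    induction N with
    | zero => simp
    | succ n ih =>
      rw [Finset.sum_Ioc_succ_top (Nat.zero_le n), ← ih, Nat.factorial_succ, Nat.cast_mul,
        Real.log_mul (by positivity) (by positivity), add_comm]
      rfl
  rw [hlog, sum_Ioc_mul_zeta_eq_sum]
  refine Finset.sum_subset (Finset.Ioc_subset_Ioc_right h) fun d hd hd' => ?_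
  have : N < d := by
    simp only [Finset.mem_Ioc] at hd hd'
    omega
  simp [Nat.div_eq_of_lt this]

lemma log_factorial_le {n : ℕ} (hn : n ≠ 0) :
    Real.log (n.factorial : ℝ) ≤ n * Real.log n - n + Real.log n / 2 + 1 := by
  obtain ⟨m, rfl⟩ := Nat.exists_eq_succ_of_ne_zero hn
  have h := Stirling.log_stirlingSeq'_antitone (Nat.zero_le m)
  have h1 : Real.log (Stirling.stirlingSeq 1) = 1 - Real.log 2 / 2 := by
    rw [Stirling.stirlingSeq_one, Real.log_div (by positivity) (by positivity), Real.log_exp,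
      Real.log_sqrt (by norm_num)]
  simp only [Function.comp_apply, Nat.succ_eq_add_one, zero_add] at h
  rw [h1, Stirling.log_stirlingSeq_formula, Real.log_mul (by norm_num) (by positivity),
    Real.log_div (by positivity) (by positivity), Real.log_exp] at h
  simp only [Nat.succ_eq_add_one]
  linarith

lemma log_factorial_comb_le_psi (M : ℕ) :
    Real.log ((30 * M).factorial : ℝ) + Real.log (M.factorial : ℝ)
      - Real.log ((15 * M).factorial : ℝ) - Real.log ((10 * M).factorial : ℝ)
      - Real.log ((6 * M).factorial : ℝ) ≤ psi ((30 * M : ℕ) : ℝ) := by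
  rw [log_factorial_eq_sum_vonMangoldt (le_refl (30 * M)),
    log_factorial_eq_sum_vonMangoldt (show M ≤ 30 * M by omega),
    log_factorial_eq_sum_vonMangoldt (show 15 * M ≤ 30 * M by omega),
    log_factorial_eq_sum_vonMangoldt (show 10 * M ≤ 30 * M by omega),
    log_factorial_eq_sum_vonMangoldt (show 6 * M ≤ 30 * M by omega),
    ← Finset.sum_add_distrib, ← Finset.sum_sub_distrib, ← Finset.sum_sub_distrib,
    ← Finset.sum_sub_distrib, psi, Nat.floor_natCast]
  refine Finset.sum_le_sum fun d _ => ?_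
  have key : 30 * M / d + M / d ≤ 15 * M / d + 10 * M / d + 6 * M / d + 1 := by
    have e (a b : ℕ) (hb : 0 < b) : a * M / d = b * a * M / d / b := by
      rw [mul_assoc, Nat.div_div_eq_div_mul, mul_comm d b,
        Nat.mul_div_mul_left _ _ hb]
    have h1 := e 1 30 (by norm_num)
    have h2 := e 15 2 (by norm_num)
    have h3 := e 10 3 (by norm_num)
    have h4 := e 6 5 (by norm_num)
    norm_num at h1 h2 h3 h4
    omega
  have key' : ((30 * M / d : ℕ) : ℝ) + ((M / d : ℕ) : ℝ) ≤
      ((15 * M / d : ℕ) : ℝ) + ((10 * M / d : ℕ) : ℝ) + ((6 * M / d : ℕ) : ℝ) + 1 := by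
    exact_mod_cast key
  nlinarith [vonMangoldt_nonneg (n := d)]

lemma chebyshev_constant_bound :
    27.61 ≤ 14 * Real.log 2 + 9 * Real.log 3 + 5 * Real.log 5 := by
  have h : Real.log ((2 : ℝ) ^ 239) ≤ Real.log (((2 : ℝ) ^ 14 * 3 ^ 9 * 5 ^ 5) ^ 6) :=
    Real.log_le_log (by positivity) (by norm_num)
  rw [Real.log_pow, Real.log_pow, Real.log_mul (by positivity) (by positivity),
    Real.log_mul (by positivity) (by positivity), Real.log_pow, Real.log_pow, Real.log_pow] at h
  have := Real.log_two_gt_d9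
  push_cast at h
  linarith

lemma psi_thirty_mul_ge {M : ℕ} (hM : M ≠ 0) :
    27.61 * M - 2 * Real.log (30 * M) - 3 ≤ psi ((30 * M : ℕ) : ℝ) := by
  refine le_trans ?_ (log_factorial_comb_le_psi M)
  have h30 := Stirling.le_log_factorial_stirling (n := 30 * M) (by omega)
  have h1 := Stirling.le_log_factorial_stirling hM
  have h15 := log_factorial_le (n := 15 * M) (by omega)
  have h10 := log_factorial_le (n := 10 * M) (by omega)
  have h6 := log_factorial_le (n := 6 * M) (by omega)
  have hM' : (1 : ℝ) ≤ M := by exact_mod_cast Nat.one_le_iff_ne_zero.2 hM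
  have hM0 : (M : ℝ) ≠ 0 := by positivity
  have l30 : Real.log 30 = Real.log 2 + Real.log 3 + Real.log 5 := by
    rw [← Real.log_mul (by norm_num) (by norm_num), ← Real.log_mul (by norm_num) (by norm_num)]
    norm_num
  have l15 : Real.log 15 = Real.log 3 + Real.log 5 := by
    rw [← Real.log_mul (by norm_num) (by norm_num)]
    norm_num
  have l10 : Real.log 10 = Real.log 2 + Real.log 5 := by
    rw [← Real.log_mul (by norm_num) (by norm_num)]
    norm_num
  have l6 : Real.log 6 = Real.log 2 + Real.log 3 := by
    rw [← Real.log_mul (by norm_num) (by norm_num)]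
    norm_num
  push_cast at h30 h1 h15 h10 h6
  rw [Real.log_mul (by norm_num) hM0] at h30 h15 h10 h6 ⊢
  rw [l30] at h30 ⊢
  rw [l15] at h15
  rw [l10] at h10
  rw [l6] at h6
  have hp : 0 ≤ Real.log (2 * Real.pi) := Real.log_nonneg (by linarith [Real.two_le_pi])
  have hl := Real.log_nonneg hM'
  have h2 : 0 ≤ Real.log 2 := Real.log_nonneg (by norm_num)
  have h3 : 0 ≤ Real.log 3 := Real.log_nonneg (by norm_num)
  have h5 : 0 ≤ Real.log 5 := Real.log_nonneg (by norm_num)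
  have hc := mul_le_mul_of_nonneg_right chebyshev_constant_bound (Nat.cast_nonneg (α := ℝ) M)
  linarith

lemma log_ten_pow_ten_le : Real.log (10 ^ 10) ≤ 24 := by
  have h : Real.log ((10 : ℝ) ^ 10) ≤ Real.log ((2 : ℝ) ^ 34) :=
    Real.log_le_log (by positivity) (by norm_num)
  rw [Real.log_pow 2 34] at h
  have := Real.log_two_lt_d9
  push_cast at h
  linarith

lemma sqrt_mul_log_le {t : ℝ} (ht : 10 ^ 10 ≤ t) : √t * Real.log t ≤ 0.00024 * t := by
  have he : Real.exp 2 ≤ 10 ^ 10 := by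
    have := Real.exp_one_lt_d9
    rw [show (2 : ℝ) = 1 + 1 by norm_num, Real.exp_add]
    nlinarith [Real.exp_pos 1]
  have h := Real.log_div_sqrt_antitoneOn (Set.mem_Ici.2 he) (Set.mem_Ici.2 (he.trans ht)) ht
  have hs : √((10 : ℝ) ^ 10) = 10 ^ 5 := by
    rw [show (10 : ℝ) ^ 10 = (10 ^ 5) ^ 2 by norm_num, Real.sqrt_sq (by positivity)]
  have ht0 : 0 < t := by linarith
  have hst : 0 < √t := Real.sqrt_pos.2 ht0
  simp only [hs] at h
  have h2 : Real.log t / √t ≤ 0.00024 := by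
    refine h.trans ?_
    rw [div_le_iff₀ (by norm_num)]
    norm_num1
    have := log_ten_pow_ten_le
    norm_num1 at this
    linarith
  rw [div_le_iff₀ hst] at h2
  nlinarith [Real.mul_self_sqrt ht0.le]

lemma theta_ge_of_large {t : ℝ} (ht : 10 ^ 10 ≤ t) : 0.918 * t ≤ theta t := by
  have ht0 : 0 < t := by linarith
  set M := ⌊t / 30⌋₊ with hM
  have hM1 : (M : ℝ) ≤ t / 30 := Nat.floor_le (by positivity)
  have hM2 : t / 30 < M + 1 := Nat.lt_floor_add_one _
  have hM0 : M ≠ 0 := by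
    intro h
    rw [h] at hM2
    norm_num at hM2
    linarith
  have hMpos : (0 : ℝ) < M := by positivity
  have h1 := psi_thirty_mul_ge hM0
  have h2 : psi ((30 * M : ℕ) : ℝ) ≤ psi t := psi_mono (by push_cast; linarith)
  have h3 := psi_sub_theta_le (x := t) (by linarith)
  have h4 := sqrt_mul_log_le ht
  have h5 : Real.log (30 * M) ≤ Real.log t := Real.log_le_log (by positivity) (by linarith)
  have h6 : Real.log t ≤ √t * Real.log t := by
    have : 1 ≤ √t := Real.one_le_sqrt.2 (by linarith)
    nlinarith [Real.log_nonneg (show (1 : ℝ) ≤ t by linarith)]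
  linarith

lemma primeCounting_ge_of_large {x : ℝ} (hx : 10 ^ 11 ≤ x) :
    0.918 * x * (1 / Real.log x + 0.9 / Real.log x ^ 2) ≤ Nat.primeCounting ⌊x⌋₊ := by
  rw [primeCounting_eq_theta_div_log_add_integral (by linarith)]
  have hx0 : 0 < x := by linarith
  have hl : 0 < Real.log x := Real.log_pos (by linarith)
  have hint {a b : ℝ} (ha : 2 ≤ a) (hab : a ≤ b) :
      IntervalIntegrable (fun t => theta t / (t * Real.log t ^ 2)) MeasureTheory.volume a b := by
    rw [intervalIntegrable_iff_integrableOn_Icc_of_le hab]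
    exact (integrableOn_theta_div_id_mul_log_sq b).mono_set (Set.Icc_subset_Icc_left ha)
  have h1 : ∫ t in (x / 10)..x, 0.918 / Real.log x ^ 2 ≤
      ∫ t in (x / 10)..x, theta t / (t * Real.log t ^ 2) := by
    refine intervalIntegral.integral_mono_on (by linarith) (by simp) (hint (by linarith)
      (by linarith)) fun t ht => ?_
    have ht0 : 0 < t := by linarith [ht.1]
    have hlt : 0 < Real.log t := Real.log_pos (by linarith [ht.1])
    have hlt' : Real.log t ≤ Real.log x := Real.log_le_log ht0 ht.2
    have hth := theta_ge_of_large (t := t) (by linarith [ht.1])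
    rw [div_le_div_iff₀ (by positivity) (by positivity)]
    have := mul_le_mul hth (pow_le_pow_left₀ hlt.le hlt' 2) (by positivity) (theta_nonneg t)
    linarith
  have h2 : 0 ≤ ∫ t in (2 : ℝ)..(x / 10), theta t / (t * Real.log t ^ 2) :=
    intervalIntegral.integral_nonneg (by linarith) fun t ht =>
      div_nonneg (theta_nonneg t) (mul_nonneg (by linarith [ht.1]) (by positivity))
  rw [← intervalIntegral.integral_add_adjacent_intervals (hint (b := x / 10) le_rfl (by linarith))
    (hint (b := x) (by linarith) (by linarith))]
  rw [intervalIntegral.integral_const, smul_eq_mul] at h1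
  have h3 : 0.918 * x / Real.log x ≤ theta x / Real.log x := by
    gcongr
    exact theta_ge_of_large (by linarith)
  have h4 : 0.918 * x * (1 / Real.log x + 0.9 / Real.log x ^ 2) =
      0.918 * x / Real.log x + (x - x / 10) * (0.918 / Real.log x ^ 2) := by
    ring
  linarith

end ChebyshevBound

section PrimesNotDividing

/-- The number of primes `p ≤ N` that do not divide `k`. -/
def countPrimesNotDvd (k N : ℕ) : ℕ :=
  ((Finset.range (N + 1)).filter fun p => p.Prime ∧ ¬ p ∣ k).card

lemma IsPInteger.exists_prime_mod_eq {k N r : ℕ} (hk : IsPInteger k)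
    (hN : k.totient ≤ countPrimesNotDvd k N) (hr : r < k) (hc : r.Coprime k) :
    ∃ p, p.Prime ∧ p ≤ N ∧ p % k = r := by
  obtain ⟨hk1, -, himage⟩ := hk
  have hmem : r ∈ (fun i => nthPrimeNotDvd k i % k) '' Set.Iio k.totient := himage ▸ ⟨hr, hc⟩
  obtain ⟨i, hi, rfl⟩ := hmem
  have hinf : (Set.ofPred fun p => p.Prime ∧ ¬ p ∣ k).Infinite := by
    refine (Nat.infinite_setOfPred_prime.sdiff (Set.finite_Iic k)).mono fun p hp =>
      ⟨hp.1, fun hd => ?_⟩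
    exact hp.2 (Nat.le_of_dvd (by omega) hd)
  have hlt : i < Nat.count (fun p => p.Prime ∧ ¬ p ∣ k) (N + 1) := by
    rw [Nat.count_eq_card_filter_range]
    exact lt_of_lt_of_le hi hN
  exact ⟨_, (Nat.nth_mem_of_infinite hinf i).1, Nat.lt_succ_iff.1 (Nat.nth_lt_of_lt_count hlt), rfl⟩

lemma primeCounting_le_countPrimesNotDvd_add {k : ℕ} (hk : k ≠ 0) (N : ℕ) :
    Nat.primeCounting N ≤ countPrimesNotDvd k N + k.primeFactors.card := by
  rw [Nat.primeCounting, Nat.primeCounting', Nat.count_eq_card_filter_range, countPrimesNotDvd]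
  refine (Finset.card_le_card fun p hp => ?_).trans (Finset.card_union_le _ _)
  simp only [Finset.mem_union, Finset.mem_filter, Nat.mem_primeFactors] at hp ⊢
  tauto

lemma mul_pow_card_le_of_primeFactors {k d b : ℕ} (hk : k ≠ 0) {S : Finset ℕ}
    (hS : S ⊆ k.primeFactors) (hd : d = ∏ p ∈ k.primeFactors \ S, p) (hb : ∀ p ∈ S, b ≤ p) :
    d * b ^ S.card ≤ k := by
  calc d * b ^ S.card ≤ d * ∏ p ∈ S, p :=
        Nat.mul_le_mul_left _ (Finset.pow_card_le_prod S _ b hb)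
    _ = ∏ p ∈ k.primeFactors, p := by rw [hd, Finset.prod_sdiff hS]
    _ ≤ k := Nat.le_of_dvd (Nat.pos_of_ne_zero hk) (Nat.prod_primeFactors_dvd k)

lemma card_primeFactors_lt {k n : ℕ} (hk : k ≠ 0) (hkn : k < 2 ^ n) :
    k.primeFactors.card < n := by
  have h := mul_pow_card_le_of_primeFactors (b := 2) hk (Finset.Subset.refl _) rfl
    fun p hp => (Nat.prime_of_mem_primeFactors hp).two_le
  rw [Finset.sdiff_self, Finset.prod_empty, one_mul] at h
  exact (Nat.pow_lt_pow_iff_right (by norm_num)).1 (h.trans_lt hkn)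

/-- `10 ^ 9` times a lower bound for `π(y) / y`, valid for all real `10 ^ 11 ≤ y ≤ N`. -/
def piRate (N : ℕ) : ℕ :=
  let B := ((N ^ 8).log2 + 1) * 866434
  918 * 10 ^ 13 * (B + 9 * 10 ^ 6) / (B * B)

lemma piRate_mul_le {N : ℕ} {y : ℝ} (hy : 10 ^ 11 ≤ y) (hyN : y ≤ N) :
    piRate N * y ≤ 10 ^ 9 * Nat.primeCounting ⌊y⌋₊ := by
  have hy0 : 0 < y := by linarith
  have hl : 0 < Real.log y := Real.log_pos (by linarith)
  set b := (N ^ 8).log2 + 1 with hb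
  have hlog : Real.log y ≤ (b * 866434 : ℕ) / 10 ^ 7 := by
    have h1 : y ^ 8 ≤ (2 : ℝ) ^ b := by
      have h2 : N ^ 8 < 2 ^ b := Nat.lt_log2_self
      have h3 : ((N : ℝ)) ^ 8 < 2 ^ b := by exact_mod_cast h2
      exact (pow_le_pow_left₀ hy0.le hyN 8).trans h3.le
    have h4 := Real.log_le_log (by positivity) h1
    rw [Real.log_pow, Real.log_pow] at h4
    have h5 := Real.log_two_lt_d9
    have h6 : (b : ℝ) * Real.log 2 ≤ b * 0.6931471808 := by gcongr
    push_cast at h4 ⊢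
    linarith
  set B := b * 866434 with hB
  have hB0 : (0 : ℝ) < B := by
    have : 0 < B := by omega
    exact_mod_cast this
  have hrate : (piRate N : ℝ) ≤ 918 * 10 ^ 13 * (B + 9 * 10 ^ 6) / (B * B) := by
    refine (Nat.cast_div_le (m := 918 * 10 ^ 13 * (B + 9 * 10 ^ 6)) (n := B * B)).trans_eq ?_
    rw [Nat.cast_mul B B]
    congr 1
    push_cast
    norm_num
  have hpi := primeCounting_ge_of_large hy
  have hinv : 10 ^ 7 / (B : ℝ) ≤ 1 / Real.log y := by
    rw [div_le_div_iff₀ hB0 hl]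
    rw [le_div_iff₀ (by norm_num)] at hlog
    linarith
  have hsq : (10 ^ 7 / (B : ℝ)) ^ 2 ≤ (1 / Real.log y) ^ 2 := by gcongr
  have hid : 918 * 10 ^ 13 * ((B : ℝ) + 9 * 10 ^ 6) / (B * B) =
      10 ^ 9 * (0.918 * (10 ^ 7 / B + 0.9 * (10 ^ 7 / (B : ℝ)) ^ 2)) := by
    field_simp
    ring
  calc piRate N * y ≤ 10 ^ 9 * (0.918 * (10 ^ 7 / B + 0.9 * (10 ^ 7 / (B : ℝ)) ^ 2)) * y := by
        rw [← hid]; gcongr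
    _ ≤ 10 ^ 9 * (0.918 * (1 / Real.log y + 0.9 * (1 / Real.log y) ^ 2)) * y := by gcongr
    _ = 10 ^ 9 * (0.918 * y * (1 / Real.log y + 0.9 / Real.log y ^ 2)) := by ring
    _ ≤ _ := by gcongr

lemma totient_le_countPrimesNotDvd {k hi u d x : ℕ} (hk : 10 ^ 11 < k) (hk' : k < 2 ^ 45)
    (hhi : k ≤ hi) (hd : 0 < d) (hu : k.totient * d ≤ u * k) (hx : 64 ≤ x)
    (hx' : x * d ≤ 64 * 37 * u) (hK0 : 0 < piRate (37 * u * hi / d + 1))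
    (hxu : 64 * u * 10 ^ 9 / (d * piRate (37 * u * hi / d + 1)) + 2 ≤ x) :
    k.totient ≤ countPrimesNotDvd k (x * k / 64) := by
  set N := 37 * u * hi / d + 1 with hN
  set K := piRate N with hK
  have hy : (10 : ℝ) ^ 11 ≤ (x * k : ℕ) / (64 : ℕ) := by
    rw [le_div_iff₀ (by norm_num)]
    have : 10 ^ 11 * 64 ≤ x * k := by nlinarith
    exact_mod_cast this
  have hyN : ((x * k : ℕ) : ℝ) / (64 : ℕ) ≤ N := by
    rw [div_le_iff₀ (by norm_num)]
    have h1 : 37 * u * hi < d * N := by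
      rw [hN]
      exact Nat.lt_mul_div_succ _ hd
    have h2 : x * k * d ≤ N * 64 * d := by
      calc x * k * d = x * d * k := by ring
        _ ≤ 64 * 37 * u * hi := Nat.mul_le_mul hx' hhi
        _ = 64 * (37 * u * hi) := by ring
        _ ≤ 64 * (d * N) := by gcongr
        _ = N * 64 * d := by ring
    exact_mod_cast Nat.le_of_mul_le_mul_right h2 hd
  have hpi := piRate_mul_le hy hyN
  rw [Nat.floor_div_eq_div, ← hK] at hpi
  have hpi' : K * (x * k) ≤ 64 * (10 ^ 9 * Nat.primeCounting (x * k / 64)) := by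
    have h : (K : ℝ) * ((x * k : ℕ) / (64 : ℕ)) = K * (x * k : ℕ) / 64 := by
      push_cast
      ring
    rw [h, div_le_iff₀ (by norm_num)] at hpi
    have h2 : ((K * (x * k) : ℕ) : ℝ) ≤
        ((64 * (10 ^ 9 * Nat.primeCounting (x * k / 64)) : ℕ) : ℝ) := by
      push_cast at hpi ⊢
      linarith
    exact_mod_cast h2
  have hxK : 64 * u * 10 ^ 9 + d * K ≤ x * (d * K) := by
    have h1 := Nat.lt_mul_div_succ (64 * u * 10 ^ 9) (show 0 < d * K by positivity)
    have h2 : (64 * u * 10 ^ 9 / (d * K) + 2) * (d * K) ≤ x * (d * K) := by gcongr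
    nlinarith
  have hKbig : 10 ^ 9 < 37 * K := by
    have h1 : x * (d * K) ≤ 64 * 37 * u * K := by
      rw [← mul_assoc]
      gcongr
    have h2 : u * 10 ^ 9 < u * (37 * K) := by
      have : 0 < d * K := by positivity
      nlinarith
    exact Nat.lt_of_mul_lt_mul_left h2
  have hcard := card_primeFactors_lt (by omega) hk'
  have hcount := primeCounting_le_countPrimesNotDvd_add (k := k) (by omega) (x * k / 64)
  suffices h : k.totient + 45 ≤ Nat.primeCounting (x * k / 64) by omega
  have h1 : d * (64 * 10 ^ 9 * (k.totient + 45)) ≤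
      d * (64 * 10 ^ 9 * Nat.primeCounting (x * k / 64)) := by
    calc d * (64 * 10 ^ 9 * (k.totient + 45))
        = 64 * 10 ^ 9 * (k.totient * d) + d * (64 * 10 ^ 9 * 45) := by ring
      _ ≤ 64 * 10 ^ 9 * (u * k) + d * (K * k) := by
          refine Nat.add_le_add (Nat.mul_le_mul_left _ hu) (Nat.mul_le_mul_left _ ?_)
          have := Nat.mul_le_mul (show 27000000 ≤ K by omega) hk.le
          omega
      _ = (64 * u * 10 ^ 9 + d * K) * k := by ring
      _ ≤ x * (d * K) * k := by gcongr
      _ = d * (K * (x * k)) := by ring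
      _ ≤ d * (64 * (10 ^ 9 * Nat.primeCounting (x * k / 64))) := by gcongr
      _ = _ := by ring
  have h2 := Nat.le_of_mul_le_mul_left h1 hd
  omega

end PrimesNotDividing

section Covering

/-- Some `a` coprime to `s` is such that, for all `j < R` outside of `l`, `a + j * k` has a common
factor with `M`; moreover `s` divides `M` and accounts for all the primes dividing both `k`
and `M`. -/
structure IsCovered (k s R M : ℕ) (l : List ℕ) : Prop where
  pos : 0 < M
  dvd : s ∣ M
  dvd_of_dvd : ∀ p, p.Prime → p ∣ k → p ∣ M → p ∣ s
  exists_not_coprime : ∃ a, a.Coprime s ∧ ∀ j < R, j ∈ l ∨ ¬ (a + j * k).Coprime M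

lemma isCovered_self {k s R : ℕ} (hs : 0 < s) : IsCovered k s R s (List.range R) :=
  ⟨hs, dvd_rfl, fun _ _ _ h => h, 1, Nat.coprime_one_left s, fun _ hj => .inl (List.mem_range.2 hj)⟩

lemma IsCovered.mul_prime {k s R M q c : ℕ} {l l' : List ℕ} (h : IsCovered k s R M l)
    (hq : q.Prime) (hqk : ¬ q ∣ k) (hqM : q.Coprime M) (hl : ∀ j ∈ l, j ∈ l' ∨ j % q = c % q) :
    IsCovered k s R (M * q) l' := by
  obtain ⟨hM, hsM, hkM, a, ha, hcov⟩ := h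
  refine ⟨Nat.mul_pos hM hq.pos, hsM.mul_right q, fun p hp hpk hpM => ?_, ?_⟩
  · rcases hp.dvd_mul.1 hpM with h | h
    · exact hkM p hp hpk h
    · exact absurd ((Nat.prime_dvd_prime_iff_eq hp hq).1 h ▸ hpk) hqk
  · obtain ⟨b, hb, hb'⟩ := Nat.chineseRemainder hqM.symm a ((q - 1) * (c * k))
    refine ⟨b, ((hb.of_dvd hsM).gcd_eq.trans ha : b.gcd s = 1), fun j hj => ?_⟩
    have hold : ¬ (a + j * k).Coprime M → ¬ (b + j * k).Coprime (M * q) := fun h h' =>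
      h ((((hb.add_right (j * k)).gcd_eq).symm.trans h'.coprime_mul_right_right :))
    rcases hcov j hj with hjl | hja
    · refine (hl j hjl).imp id fun hjc h' => ?_
      have hdvd : q ∣ b + j * k := by
        have h1 : b + j * k ≡ (q - 1) * (c * k) + c * k [MOD q] :=
          hb'.add (Nat.ModEq.mul_right k hjc)
        have h2 : (q - 1) * (c * k) + c * k = q * (c * k) := by
          obtain ⟨n, rfl⟩ := Nat.exists_eq_succ_of_ne_zero hq.ne_zero
          simp only [Nat.succ_eq_add_one, Nat.add_sub_cancel]
          ring
        rw [h2] at h1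
        exact (Nat.modEq_zero_iff_dvd.1 (h1.trans (Nat.modEq_zero_iff_dvd.2 (dvd_mul_right _ _))))
      exact hq.one_lt.ne' (Nat.eq_one_of_dvd_coprimes h' hdvd (dvd_mul_left q M))
    · exact .inr (hold hja)

/-- The elements of `l` not congruent to `c` modulo `q`. -/
def sieveOut (q : ℕ) (l : List ℕ) (c : ℕ) : List ℕ :=
  l.filter fun j => !(Nat.beq (j % q) (c % q))

/-- The shorter of two lists. -/
def shorter (l l' : List ℕ) : List ℕ := bif Nat.ble l'.length l.length then l' else l

/-- Remove from `l` the residue class modulo `q` of one of its first three elements, removing as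
many elements as possible. -/
def bestSieve (q : ℕ) (l : List ℕ) : List ℕ :=
  ((l.take 3).map (sieveOut q l)).foldl shorter l

/-- Apply `bestSieve` for the moduli of a list successively until nothing is left, multiplying `M`
by the moduli used. -/
def greedyCover : List ℕ → List ℕ → ℕ → List ℕ × ℕ
  | [], l, M => (l, M)
  | _ :: _, [], M => ([], M)
  | q :: Q, j :: l, M => greedyCover Q (bestSieve q (j :: l)) (M * q)

lemma mem_sieveOut_or {q c j : ℕ} {l : List ℕ} (hj : j ∈ l) :
    j ∈ sieveOut q l c ∨ j % q = c % q := by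
  rw [sieveOut, List.mem_filter, Bool.not_eq_true', ← Bool.not_eq_true, Nat.beq_eq]
  tauto

lemma foldl_shorter_induction {P : List ℕ → Prop} {L : List (List ℕ)} {l : List ℕ} (hl : P l)
    (hL : ∀ l' ∈ L, P l') : P (L.foldl shorter l) := by
  induction L generalizing l with
  | nil => exact hl
  | cons l' L ih =>
    refine ih ?_ fun x hx => hL x (List.mem_cons_of_mem _ hx)
    rw [shorter, cond_eq_ite]
    split_ifs
    exacts [hL l' List.mem_cons_self, hl]

lemma exists_mem_bestSieve_or (q : ℕ) (l : List ℕ) :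
    ∃ c, ∀ j ∈ l, j ∈ bestSieve q l ∨ j % q = c % q := by
  refine foldl_shorter_induction (P := fun l' => ∃ c, ∀ j ∈ l, j ∈ l' ∨ j % q = c % q)
    ⟨0, fun j hj => .inl hj⟩ fun l' hl' => ?_
  obtain ⟨c, -, rfl⟩ := List.mem_map.1 hl'
  exact ⟨c, fun j hj => mem_sieveOut_or hj⟩

lemma IsCovered.greedyCover {k s R : ℕ} {Q : List ℕ} : ∀ {l : List ℕ} {M : ℕ},
    IsCovered k s R (s * M) l → Q.Nodup → (∀ q ∈ Q, q.Prime ∧ ¬ q ∣ k ∧ q.Coprime (s * M)) →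
    IsCovered k s R (s * (greedyCover Q l M).2) (greedyCover Q l M).1 ∧
      ∀ p, p.Prime → p ∉ Q → p.Coprime (s * M) → p.Coprime (s * (_root_.greedyCover Q l M).2) := by
  induction Q with
  | nil => exact fun h _ _ => ⟨h, fun p _ _ hp => hp⟩
  | cons q Q ih =>
    rintro (_ | ⟨j, l⟩) M h hnd hQ
    · exact ⟨h, fun p _ _ hp => hp⟩
    · obtain ⟨hqQ, hnd⟩ := List.nodup_cons.1 hnd
      obtain ⟨hq, hqk, hqM⟩ := hQ q List.mem_cons_self
      obtain ⟨c, hc⟩ := exists_mem_bestSieve_or q (j :: l)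
      have hstep : ∀ p, p.Prime → p ≠ q → p.Coprime (s * M) → p.Coprime (s * (M * q)) := by
        intro p hp hpq hpM
        rw [← mul_assoc]
        exact hpM.mul_right ((Nat.coprime_primes hp hq).2 hpq)
      have h' := h.mul_prime hq hqk hqM hc
      rw [mul_assoc] at h'
      obtain ⟨h1, h2⟩ := ih h' hnd fun p hp => by
        obtain ⟨hp1, hp2, hp3⟩ := hQ p (List.mem_cons_of_mem _ hp)
        exact ⟨hp1, hp2, hstep p hp1 (fun e => hqQ (e ▸ hp)) hp3⟩
      refine ⟨h1, fun p hp hpQ hpM => ?_⟩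
      rw [List.mem_cons, not_or] at hpQ
      exact h2 p hp hpQ.2 (hstep p hp hpQ.1 hpM)

/-- If at most `w` of the increasing primes `ps` divide `k`, the others can be used to cover
the remaining elements of `l` one by one. -/
lemma IsCovered.exists_nil {k s R : ℕ} {ps : List ℕ} : ∀ {w M : ℕ} {l : List ℕ},
    IsCovered k s R M l → ps.Pairwise (· < ·) → (∀ p ∈ ps, p.Prime ∧ p.Coprime M) →
    (ps.filter (· ∣ k)).length ≤ w → l.length ≤ (ps.drop w).length →
    ∃ M' ≤ M * ((ps.drop w).take l.length).prod, IsCovered k s R M' [] := by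
  induction ps with
  | nil =>
    intro w M l h _ _ _ hl
    obtain rfl : l = [] := by simpa using hl
    exact ⟨M, by simp, h⟩
  | cons p ps ih =>
    rintro w M (_ | ⟨j, l⟩) h hps hpM hw hl
    · exact ⟨M, by simp, h⟩
    obtain ⟨hp_lt, hps⟩ := List.pairwise_cons.1 hps
    obtain ⟨hp, hpM'⟩ := hpM p List.mem_cons_self
    by_cases hpk : p ∣ k
    · rw [List.filter_cons_of_pos (by simpa using hpk), List.length_cons] at hw
      obtain ⟨w, rfl⟩ := Nat.exists_eq_add_of_lt (Nat.lt_of_lt_of_le (Nat.succ_pos _) hw)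
      rw [Nat.zero_add] at hw hl ⊢
      rw [List.drop_succ_cons] at hl ⊢
      exact ih h hps (fun x hx => hpM x (List.mem_cons_of_mem _ hx)) (by omega) hl
    · rw [List.filter_cons_of_neg (by simpa using hpk)] at hw
      have hlen : w < (p :: ps).length := by
        rw [List.length_drop, List.length_cons] at hl
        omega
      have h' := h.mul_prime (c := j) (l' := l) hp hpk hpM' fun i hi =>
        (List.mem_cons.1 hi).symm.imp id fun e => by rw [e]
      obtain ⟨M', hM', hcov⟩ := ih (w := w) h' hps (fun x hx => by
        obtain ⟨hx1, hx2⟩ := hpM x (List.mem_cons_of_mem _ hx)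
        exact ⟨hx1, hx2.mul_right ((Nat.coprime_primes hx1 hp).2 (hp_lt x hx).ne')⟩) hw (by
          simp only [List.length_drop, List.length_cons] at hl ⊢
          omega)
      refine ⟨M', hM'.trans ?_, hcov⟩
      rw [List.drop_eq_getElem_cons hlen, List.length_cons, List.take_succ_cons, List.prod_cons,
        List.drop_succ_cons, mul_assoc]
      gcongr
      cases w with
      | zero => exact le_rfl
      | succ w => exact (hp_lt _ (List.getElem_mem _)).le

end Covering

section Window

/-- An upper bound for the number of multiples of `p` among `T` consecutive integers. -/
def killed (T p : ℕ) : ℕ := (T - 1) / p + 1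

lemma card_filter_dvd_le_killed {p M : ℕ} (hp : p.Coprime M) (b T : ℕ) :
    ((Finset.range T).filter fun t => p ∣ b + M * t).card ≤ killed T p := by
  rw [killed, ← Finset.card_range ((T - 1) / p + 1)]
  refine Finset.card_le_card_of_injOn (· / p) (fun t ht => ?_) fun t ht t' ht' h => ?_
  · have := (Finset.mem_filter.1 ht).1
    simp only [Finset.coe_range, Set.mem_Iio, Finset.mem_range, Nat.lt_succ_iff] at this ⊢
    exact Nat.div_le_div_right (Nat.le_sub_one_of_lt this)
  · have h1 := (Finset.mem_filter.1 ht).2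
    have h2 := (Finset.mem_filter.1 ht').2
    have h3 : b + M * t ≡ b + M * t' [MOD p] :=
      (Nat.modEq_zero_iff_dvd.2 h1).trans (Nat.modEq_zero_iff_dvd.2 h2).symm
    have h4 : t % p = t' % p := Nat.ModEq.cancel_left_of_coprime hp h3.add_left_cancel'
    dsimp only at h
    rw [← Nat.div_add_mod t p, ← Nat.div_add_mod t' p, h, h4]

/-- If the multiples of the prime factors of `k` that do not divide `s` cannot fill an arithmetic
progression with `T` terms, there is some `r` coprime to `k`, between `f * k / 64` and `k`, such
that none of the numbers `r + j * k` with `j < R` is prime. -/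
lemma IsCovered.exists_not_prime {k s R M f T : ℕ} (h : IsCovered k s R M [])
    (hM : 64 * (M * (T + 3)) ≤ (64 - f) * k)
    (hT : ∑ p ∈ k.primeFactors.filter (¬ · ∣ s), killed T p < T) :
    ∃ r < k, r.Coprime k ∧ f * k < 64 * r ∧ ∀ j < R, ¬ (r + j * k).Prime := by
  obtain ⟨hM0, hsM, hkM, a, ha, hcov⟩ := h
  set t₀ := f * k / 64 / M + 2 with ht₀
  set b := a % M + M * t₀ with hb
  have hk : k ≠ 0 := by
    rintro rfl
    have : 0 < 64 * (M * (T + 3)) := by positivity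
    omega
  obtain ⟨t, ht, htp⟩ : ∃ t ∈ Finset.range T, ∀ p ∈ k.primeFactors.filter (¬ · ∣ s),
      ¬ p ∣ b + M * t := by
    by_contra! hcon
    have hsub : Finset.range T ⊆ (k.primeFactors.filter (¬ · ∣ s)).biUnion
        fun p => (Finset.range T).filter fun t => p ∣ b + M * t := fun t ht => by
      obtain ⟨p, hp, hpt⟩ := hcon t ht
      exact Finset.mem_biUnion.2 ⟨p, hp, Finset.mem_filter.2 ⟨ht, hpt⟩⟩
    have hle := (Finset.card_le_card hsub).trans Finset.card_biUnion_le
    rw [Finset.card_range] at hle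
    refine (hle.trans (Finset.sum_le_sum fun p hp => ?_)).not_gt hT
    rw [Finset.mem_filter] at hp
    have hpp := Nat.prime_of_mem_primeFactors hp.1
    exact card_filter_dvd_le_killed ((hpp.coprime_iff_not_dvd).2 fun hpM =>
      hp.2 (hkM p hpp (Nat.dvd_of_mem_primeFactors hp.1) hpM)) b T
  have hmod : b + M * t ≡ a [MOD M] := by
    have : b + M * t = a % M + M * (t₀ + t) := by rw [hb]; ring
    rw [this]
    exact (Nat.ModEq.trans (by simp [Nat.ModEq]) (Nat.mod_modEq a M))
  rw [Finset.mem_range] at ht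
  have hr1 := Nat.div_mul_le_self (f * k / 64) M
  have hr2 := Nat.lt_mul_div_succ (f * k / 64) hM0
  have hr3 := Nat.mod_lt a hM0
  set v := f * k / 64 with hv
  have hbM : M * 2 + v / M * M + M * t ≤ b + M * t := by
    rw [hb, ht₀, mul_add M, mul_comm (v / M)]
    omega
  have hblt : b + M * t < M * (T + 2) + v / M * M := by
    have : M * (t + 1) ≤ M * T := Nat.mul_le_mul_left _ ht
    rw [hb, ht₀]
    nlinarith
  refine ⟨b + M * t, ?_, ?_, ?_, fun j hj hprime => ?_⟩
  · have h1 : (64 - f) * k + 64 * v ≤ 64 * k ∨ 64 ≤ f := by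
      rcases le_total 64 f with h | h
      · exact .inr h
      · left
        have := Nat.sub_mul 64 f k
        have := Nat.mul_le_mul_right k h
        omega
    rcases h1 with h1 | h1
    · nlinarith
    · rw [Nat.sub_eq_zero_of_le h1, zero_mul] at hM
      have : 0 < 64 * (M * (T + 3)) := by positivity
      omega
  · refine Nat.Coprime.symm (Nat.coprime_of_dvd fun p hp hpk hpr => ?_)
    by_cases hps : p ∣ s
    · have := (Nat.ModEq.dvd_iff hmod (hps.trans hsM)).1 hpr
      exact hp.one_lt.ne' (Nat.eq_one_of_dvd_coprimes ha this hps)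
    · exact htp p (Finset.mem_filter.2 ⟨Nat.mem_primeFactors.2 ⟨hp, hpk, hk⟩, hps⟩) hpr
  · have : f * k < 64 * (M * (v / M + 1)) := by omega
    nlinarith
  · have hnot := (hcov j hj).resolve_left List.not_mem_nil
    rw [Nat.coprime_iff_gcd_eq_one, ← (hmod.add_right (j * k)).gcd_eq] at hnot
    have hdvd := (Nat.Prime.dvd_iff_not_coprime hprime).2 hnot
    have := Nat.le_of_dvd hM0 hdvd
    nlinarith [Nat.zero_le (j * k)]

end Window

section Search

/-- An upper bound for the logarithm of `t` to base `p`, provided the first argument is large. -/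
def ilog (p : ℕ) : ℕ → ℕ → ℕ
  | 0, _ => 0
  | n + 1, t => bif Nat.blt t p then 0 else ilog p n (t / p) + 1

/-- Given a modulus `M`, and allowing for `w` prime factors `≥ p` besides the elements of `D`, test
whether `IsCovered.exists_not_prime` applies, with `s` the product of the elements of `D` below `z`
and a progression contained in an interval of length `m`. -/
def windowOK (m M w p : ℕ) (D : List ℕ) (z : ℕ) : Bool :=
  let T := min 30 (m / (M * (D.filter (Nat.blt · z)).prod) - 3)
  Nat.blt (((D.filter (Nat.ble z)).map (killed T)).sum + w * killed T p) T

/-- Test whether the primes in `Q` and then the ones in `ps`, of which at most `w` are not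
available, cover `R` terms with a modulus small enough for `windowOK`. -/
def rowsOK (m R w p : ℕ) (ps Q D : List ℕ) : Bool :=
  match greedyCover Q (List.range R) 1 with
  | (l, M) => Nat.ble l.length (ps.drop w).length &&
      [3, 5, 7, 11].any (windowOK m (M * ((ps.drop w).take l.length).prod) w p D)

/-- Test whether no `k` in `[lo, hi]` is a `P`-integer if its prime factors are those in `D` and
some primes in `ps` or larger, where `p` is the first element of `ps` and no element of `Q`
divides `k`. -/
def closes (lo hi p : ℕ) (ps Q D : List ℕ) : Bool :=
  let d := D.prod
  let u := (D.map (· - 1)).prod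
  let K := piRate (37 * u * hi / d + 1)
  let x := 64 * u * 10 ^ 9 / (d * K) + 2
  let w := ilog p 45 (hi / d)
  Nat.blt 0 K && Nat.ble 64 x && Nat.ble (x * d) (64 * 37 * u) && Nat.blt hi (d * p ^ (w + 1)) &&
    (rowsOK ((64 - x % 64) * max lo d / 64) (x / 64) w p ps Q D ||
      rowsOK (max lo d) (x / 64 + 1) w p ps Q D)

/-- Decide successively for the primes in the list whether they divide `k`, until `closes` applies
or the divisors of `k` found exceed `hi`. -/
def search (lo hi : ℕ) : List ℕ → List ℕ → List ℕ → Bool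
  | [], _, _ => false
  | p :: ps, Q, D => Nat.blt hi D.prod || closes lo hi p (p :: ps) Q D ||
      (search lo hi ps Q (p :: D) && search lo hi ps (Q ++ [p]) D)

/-- The elements of `D` divide `k`, those of `Q` do not, and those of `ps` are the next primes. -/
structure IsSearchState (k : ℕ) (ps Q D : List ℕ) : Prop where
  sorted : ps.Pairwise (· < ·)
  nodup : (ps ++ (Q ++ D)).Nodup
  prime : ∀ p ∈ ps ++ (Q ++ D), p.Prime
  not_dvd : ∀ q ∈ Q, ¬ q ∣ k
  dvd : ∀ q ∈ D, q ∣ k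
  mem_or : ∀ q, q.Prime → q ∣ k → q ∈ D ∨ q ∈ ps ∨ ∀ p ∈ ps, p < q

namespace IsSearchState

variable {k p w : ℕ} {ps Q D : List ℕ}

lemma cons_dvd (h : IsSearchState k (p :: ps) Q D) (hp : p ∣ k) :
    IsSearchState k ps Q (p :: D) where
  sorted := (List.pairwise_cons.1 h.sorted).2
  nodup := by
    refine (List.Perm.nodup_iff ?_).2 h.nodup
    rw [← List.append_assoc, ← List.append_assoc]
    exact List.perm_middle
  prime q hq := h.prime q (by simp only [List.mem_append, List.mem_cons] at hq ⊢; tauto)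
  not_dvd := h.not_dvd
  dvd q hq := (List.mem_cons.1 hq).elim (fun e => e ▸ hp) (h.dvd q)
  mem_or q hq hqk := by
    have := h.mem_or q hq hqk
    simp only [List.mem_cons, forall_eq_or_imp] at this ⊢
    tauto

lemma append_not_dvd (h : IsSearchState k (p :: ps) Q D) (hp : ¬ p ∣ k) :
    IsSearchState k ps (Q ++ [p]) D where
  sorted := (List.pairwise_cons.1 h.sorted).2
  nodup := by
    refine (List.Perm.nodup_iff ?_).2 h.nodup
    rw [← List.append_assoc, ← List.append_assoc, ← List.append_assoc, List.append_assoc (ps ++ Q)]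
    exact List.perm_middle
  prime q hq := h.prime q (by
    simp only [List.mem_append, List.mem_cons, List.not_mem_nil] at hq ⊢; tauto)
  not_dvd q hq := by
    rcases List.mem_append.1 hq with hq | hq
    · exact h.not_dvd q hq
    · exact List.mem_singleton.1 hq ▸ hp
  dvd := h.dvd
  mem_or q hq hqk := by
    have := h.mem_or q hq hqk
    simp only [List.mem_cons, forall_eq_or_imp] at this ⊢
    refine this.imp id fun h' => ?_
    rcases h' with (rfl | h') | h'
    exacts [absurd hqk hp, .inl h', .inr h'.2]

lemma nodup_right (h : IsSearchState k ps Q D) : D.Nodup :=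
  h.nodup.of_append_right.of_append_right

lemma subset_primeFactors (h : IsSearchState k ps Q D) (hk : k ≠ 0) :
    D.toFinset ⊆ k.primeFactors := fun q hq => by
  rw [List.mem_toFinset] at hq
  exact Nat.mem_primeFactors.2 ⟨h.prime q (by simp [hq]), h.dvd q hq, hk⟩

lemma prod_eq (h : IsSearchState k ps Q D) (f : ℕ → ℕ) :
    ∏ q ∈ D.toFinset, f q = (D.map f).prod := List.prod_toFinset f h.nodup_right

lemma prod_pos (h : IsSearchState k ps Q D) : 0 < D.prod :=
  List.prod_pos fun q hq => (h.prime q (by simp [hq])).pos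

lemma prod_le (h : IsSearchState k ps Q D) (hk : k ≠ 0) : D.prod ≤ k := by
  have h1 := h.prod_eq id
  rw [List.map_id] at h1
  rw [← h1]
  exact Nat.le_of_dvd (Nat.pos_of_ne_zero hk)
    ((Finset.prod_dvd_prod_of_subset _ _ _ (h.subset_primeFactors hk)).trans
      (Nat.prod_primeFactors_dvd k))

lemma totient_mul_le (h : IsSearchState k ps Q D) (hk : k ≠ 0) :
    k.totient * D.prod ≤ (D.map (· - 1)).prod * k := by
  have hsub := h.subset_primeFactors hk
  have h1 := h.prod_eq id
  rw [List.map_id] at h1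
  rw [← h1, ← h.prod_eq]
  have htot := Nat.totient_mul_prod_primeFactors k
  rw [← Finset.prod_sdiff hsub, ← Finset.prod_sdiff hsub] at htot
  set P := ∏ q ∈ k.primeFactors \ D.toFinset, q with hP
  have hP0 : 0 < P := Finset.prod_pos fun q hq =>
    (Nat.prime_of_mem_primeFactors (Finset.mem_sdiff.1 hq).1).pos
  have hle : ∏ q ∈ k.primeFactors \ D.toFinset, (q - 1) ≤ P :=
    Finset.prod_le_prod' fun q _ => Nat.sub_le q 1
  refine Nat.le_of_mul_le_mul_left ?_ hP0
  calc P * (k.totient * ∏ q ∈ D.toFinset, id q)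
      = k.totient * (P * ∏ q ∈ D.toFinset, q) := by simp only [id]; ring
    _ = k * ((∏ q ∈ k.primeFactors \ D.toFinset, (q - 1)) * ∏ q ∈ D.toFinset, (q - 1)) := htot
    _ ≤ k * (P * ∏ q ∈ D.toFinset, (q - 1)) := by gcongr
    _ = P * ((∏ q ∈ D.toFinset, (q - 1)) * k) := by ring

lemma le_of_mem_sdiff (h : IsSearchState k (p :: ps) Q D) {q : ℕ}
    (hq : q ∈ k.primeFactors \ D.toFinset) : p ≤ q := by
  rw [Finset.mem_sdiff, List.mem_toFinset, Nat.mem_primeFactors] at hq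
  rcases (h.mem_or q hq.1.1 hq.1.2.1).resolve_left hq.2 with h' | h'
  · rcases List.mem_cons.1 h' with rfl | h'
    exacts [le_rfl, ((List.pairwise_cons.1 h.sorted).1 q h').le]
  · exact (h' p List.mem_cons_self).le

lemma card_sdiff_le (h : IsSearchState k (p :: ps) Q D) (hk : k ≠ 0)
    (hw : k < D.prod * p ^ (w + 1)) : (k.primeFactors \ D.toFinset).card ≤ w := by
  have h1 : D.prod = ∏ q ∈ k.primeFactors \ (k.primeFactors \ D.toFinset), q := by
    rw [Finset.sdiff_sdiff_eq_self (h.subset_primeFactors hk), h.prod_eq fun q => q, List.map_id']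
  have h2 := mul_pow_card_le_of_primeFactors hk Finset.sdiff_subset h1 fun _ hq =>
    h.le_of_mem_sdiff hq
  have h3 := Nat.lt_of_mul_lt_mul_left (h2.trans_lt hw)
  exact Nat.lt_succ_iff.1 ((Nat.pow_lt_pow_iff_right (h.prime p (by simp)).one_lt).1 h3)

lemma length_filter_le (h : IsSearchState k (p :: ps) Q D) (hk : k ≠ 0)
    (hw : k < D.prod * p ^ (w + 1)) : ((p :: ps).filter (· ∣ k)).length ≤ w := by
  rw [← List.toFinset_card_of_nodup (h.nodup.of_append_left.filter _)]
  refine (Finset.card_le_card fun q hq => ?_).trans (h.card_sdiff_le hk hw)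
  rw [List.mem_toFinset, List.mem_filter, decide_eq_true_iff] at hq
  have hqD : q ∉ D := fun hqD =>
    List.disjoint_of_nodup_append h.nodup hq.1 (List.mem_append_right _ hqD)
  rw [Finset.mem_sdiff, List.mem_toFinset, Nat.mem_primeFactors]
  exact ⟨⟨h.prime q (List.mem_append_left _ hq.1), hq.2, hk⟩, hqD⟩

lemma sum_killed_le (h : IsSearchState k (p :: ps) Q D) (hk : k ≠ 0)
    (hw : k < D.prod * p ^ (w + 1)) (T z : ℕ) :
    ∑ q ∈ k.primeFactors.filter (¬ · ∣ (D.filter (Nat.blt · z)).prod), killed T q ≤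
      ((D.filter (Nat.ble z)).map (killed T)).sum + w * killed T p := by
  have hsub : k.primeFactors.filter (¬ · ∣ (D.filter (Nat.blt · z)).prod) ⊆
      (D.filter (Nat.ble z)).toFinset ∪ (k.primeFactors \ D.toFinset) := fun q hq => by
    rw [Finset.mem_filter] at hq
    by_cases hqD : q ∈ D
    · refine Finset.mem_union_left _ (List.mem_toFinset.2 (List.mem_filter.2 ⟨hqD, ?_⟩))
      by_contra hz
      refine hq.2 (List.dvd_prod (List.mem_filter.2 ⟨hqD, ?_⟩))
      rw [Nat.ble_eq] at hz
      exact Nat.blt_eq.mpr (not_le.1 hz)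
    · exact Finset.mem_union_right _ (Finset.mem_sdiff.2 ⟨hq.1, by simpa using hqD⟩)
  have hanti : ∀ q ∈ k.primeFactors \ D.toFinset, killed T q ≤ killed T p := fun q hq =>
    Nat.succ_le_succ (Nat.div_le_div_left (h.le_of_mem_sdiff hq) (h.prime p (by simp)).pos)
  calc _ ≤ _ := Finset.sum_le_sum_of_subset hsub
    _ ≤ ∑ q ∈ (D.filter (Nat.ble z)).toFinset, killed T q +
        ∑ q ∈ k.primeFactors \ D.toFinset, killed T q := by
      rw [← Finset.sum_union_inter]
      exact Nat.le_add_right _ _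
    _ ≤ _ := by
      rw [List.sum_toFinset _ (h.nodup_right.filter _)]
      refine Nat.add_le_add_left ((Finset.sum_le_card_nsmul _ _ _ hanti).trans ?_) _
      rw [smul_eq_mul]
      exact Nat.mul_le_mul_right _ (h.card_sdiff_le hk hw)

lemma exists_not_prime (h : IsSearchState k (p :: ps) Q D) (hk : k ≠ 0) {m R f : ℕ}
    (hw : k < D.prod * p ^ (w + 1)) (hm : 64 * m ≤ (64 - f) * k)
    (hrows : rowsOK m R w p (p :: ps) Q D = true) :
    ∃ r < k, r.Coprime k ∧ f * k < 64 * r ∧ ∀ j < R, ¬ (r + j * k).Prime := by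
  rw [rowsOK, Bool.and_eq_true, Nat.ble_eq, List.any_eq_true] at hrows
  obtain ⟨hlen, z, -, hz⟩ := hrows
  set l := (greedyCover Q (List.range R) 1).1
  set M := (greedyCover Q (List.range R) 1).2 with hM
  set s := (D.filter (Nat.blt · z)).prod with hs
  rw [windowOK, Nat.blt_eq, ← hs] at hz
  set N := M * (((p :: ps).drop w).take l.length).prod with hN
  set T := min 30 (m / (N * s) - 3) with hT
  have hs0 : 0 < s := List.prod_pos fun q hq =>
    (h.prime q (by simp [List.mem_of_mem_filter hq])).pos
  have hcop : ∀ q, q.Prime → q ∉ D → q.Coprime (s * 1) := fun q hq hqD => by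
    rw [mul_one, Nat.coprime_list_prod_right_iff]
    intro q' hq'
    have hq'D := List.mem_of_mem_filter hq'
    exact (Nat.coprime_primes hq (h.prime q' (by simp [hq'D]))).2 fun e => hqD (e ▸ hq'D)
  have hdisj := List.disjoint_of_nodup_append h.nodup
  have hdisj' := List.disjoint_of_nodup_append h.nodup.of_append_right
  have hstart : IsCovered k s R (s * 1) (List.range R) := by
    rw [mul_one]
    exact isCovered_self hs0
  obtain ⟨hcov, hcop'⟩ := hstart.greedyCover h.nodup.of_append_right.of_append_left fun q hq =>
    have hqp := h.prime q (by simp [hq])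
    ⟨hqp, h.not_dvd q hq, hcop q hqp fun hqD => hdisj' hq hqD⟩
  obtain ⟨M', hM', hcov'⟩ := hcov.exists_nil h.sorted (fun q hq =>
    have hqp := h.prime q (List.mem_append_left _ hq)
    ⟨hqp, hcop' q hqp (fun hqQ => hdisj hq (List.mem_append_left _ hqQ))
      (hcop q hqp fun hqD => hdisj hq (List.mem_append_right _ hqD))⟩)
    (h.length_filter_le hk hw) hlen
  refine hcov'.exists_not_prime (T := T) (le_trans ?_ hm)
    ((h.sum_killed_le hk hw T z).trans_lt hz)
  have hT0 : T + 3 ≤ m / (N * s) := by omega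
  gcongr
  calc M' * (T + 3) ≤ s * M * (((p :: ps).drop w).take l.length).prod * (m / (N * s)) := by gcongr
    _ = N * s * (m / (N * s)) := by rw [hN]; ring
    _ ≤ m := Nat.mul_div_le _ _

lemma not_isPInteger_of_closes {lo hi : ℕ} (h : IsSearchState k (p :: ps) Q D)
    (hk : 10 ^ 11 < k) (hk' : k < 2 ^ 45) (hlo : lo ≤ k) (hhi : k ≤ hi)
    (hc : closes lo hi p (p :: ps) Q D = true) : ¬ IsPInteger k := by
  intro hP
  have hk0 : k ≠ 0 := by omega
  have hmax : max lo D.prod ≤ k := max_le hlo (h.prod_le hk0)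
  simp only [closes, Bool.and_eq_true, Bool.or_eq_true, Nat.blt_eq, Nat.ble_eq] at hc
  set K := piRate (37 * (D.map (· - 1)).prod * hi / D.prod + 1) with hK
  set x := 64 * (D.map (· - 1)).prod * 10 ^ 9 / (D.prod * K) + 2 with hx
  obtain ⟨⟨⟨⟨hK0, hx64⟩, hxd⟩, hw⟩, hrows⟩ := hc
  have hcount := totient_le_countPrimesNotDvd hk hk' hhi h.prod_pos (h.totient_mul_le hk0)
    hx64 hxd hK0 hx.ge
  obtain ⟨f, R, hfR, r, hr, hrk, hfr, hnp⟩ : ∃ f R, x ≤ f + 64 * R ∧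
      ∃ r < k, r.Coprime k ∧ f * k < 64 * r ∧ ∀ j < R, ¬ (r + j * k).Prime := by
    rcases hrows with hrows | hrows
    · refine ⟨x % 64, x / 64, by omega, h.exists_not_prime hk0 (hhi.trans_lt hw) ?_ hrows⟩
      exact (Nat.mul_div_le _ _).trans (Nat.mul_le_mul_left _ hmax)
    · refine ⟨0, x / 64 + 1, by omega, h.exists_not_prime hk0 (hhi.trans_lt hw) ?_ hrows⟩
      exact Nat.mul_le_mul_left _ hmax
  obtain ⟨q, hq, hqx, hqr⟩ := hP.exists_prime_mod_eq hcount hr hrk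
  have hqeq : r + q / k * k = q := by rw [← hqr, mul_comm, Nat.mod_add_div]
  refine hnp (q / k) (lt_of_not_ge fun hR => ?_) (hqeq.symm ▸ hq)
  have h1 : 64 * q ≤ x * k := by omega
  have h2 : x * k ≤ (f + 64 * R) * k := Nat.mul_le_mul_right k hfR
  have h3 : R * k ≤ q / k * k := Nat.mul_le_mul_right k hR
  have h4 : (f + 64 * R) * k = f * k + 64 * (R * k) := by ring
  omega

lemma not_isPInteger_of_search {lo hi : ℕ} (h : IsSearchState k ps Q D)
    (hk : 10 ^ 11 < k) (hk' : k < 2 ^ 45) (hlo : lo ≤ k) (hhi : k ≤ hi)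
    (hs : search lo hi ps Q D = true) : ¬ IsPInteger k := by
  induction ps generalizing Q D with
  | nil => simp [search] at hs
  | cons p ps ih =>
    rw [search, Bool.or_eq_true, Bool.or_eq_true, Bool.and_eq_true, Nat.blt_eq] at hs
    rcases hs with (hs | hs) | ⟨hs, hs'⟩
    · exact absurd ((h.prod_le (by omega)).trans hhi) hs.not_ge
    · exact h.not_isPInteger_of_closes hk hk' hlo hhi hs
    · by_cases hp : p ∣ k
      · exact ih (h.cons_dvd hp) hs
      · exact ih (h.append_not_dvd hp) hs'

end IsSearchState

/-- The primes below `300`. -/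
def smallPrimes : List ℕ := [2, 3, 5, 7, 11, 13, 17, 19, 23, 29, 31, 37, 41, 43, 47, 53, 59, 61,
  67, 71, 73, 79, 83, 89, 97, 101, 103, 107, 109, 113, 127, 131, 137, 139, 149, 151, 157, 163,
  167, 173, 179, 181, 191, 193, 197, 199, 211, 223, 227, 229, 233, 239, 241, 251, 257, 263, 269,
  271, 277, 281, 283, 293]

lemma prime_of_mem_smallPrimes : ∀ p ∈ smallPrimes, p.Prime := by
  simp only [smallPrimes, List.forall_mem_cons]
  norm_num

lemma mem_smallPrimes : ∀ p < 294, p.Prime → p ∈ smallPrimes := by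
  decide +kernel

lemma isSearchState_smallPrimes (k : ℕ) : IsSearchState k smallPrimes [] [] where
  sorted := by decide
  nodup := by decide
  prime p hp := prime_of_mem_smallPrimes p (by simpa using hp)
  not_dvd := by simp
  dvd := by simp
  mem_or q hq _ := by
    rcases lt_or_ge q 294 with h | h
    · exact .inr (.inl (mem_smallPrimes q h hq))
    · refine .inr (.inr fun p hp => lt_of_lt_of_le ?_ h)
      revert p
      decide

/-- Consecutive endpoints, in units of `10 ^ 9`, of the intervals treated by `search`. -/
def searchBins : List (ℕ × ℕ) := [(100, 204), (204, 416), (416, 849), (849, 1732), (1732, 3533),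
  (3533, 7208), (7208, 14705), (14705, 30000)]

lemma search_searchBins : ∀ b ∈ searchBins,
    search (b.1 * 10 ^ 9) (b.2 * 10 ^ 9) smallPrimes [] [] = true := by
  decide +kernel

lemma exists_mem_searchBins {k : ℕ} (h1 : 10 ^ 11 < k) (h2 : k < 3 * 10 ^ 13) :
    ∃ b ∈ searchBins, b.1 * 10 ^ 9 ≤ k ∧ k ≤ b.2 * 10 ^ 9 := by
  simp only [searchBins, List.exists_mem_cons_iff]
  omega

end Search

theorem no_PInteger_between_of_RH (hRH : RiemannHypothesis) (k : ℕ)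
    (h1 : 10 ^ 11 < k) (h2 : k < 3 * 10 ^ 13) : ¬ IsPInteger k := by
  obtain ⟨b, hb, hlo, hhi⟩ := exists_mem_searchBins h1 h2
  exact (isSearchState_smallPrimes k).not_isPInteger_of_search h1 (by omega) hlo hhi
    (search_searchBins b hb)
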